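/- Let θ : [0,∞) → [0,∞) be continuous with θ(t) ≥ c > 0 for all large t. Then for any ε ∈ (0,1), linear growth of θ cannot be consistent with ∫₀^t θ² ≤ C₁ + C₂ t^ε θ(t)^{1-ε} for all large t when θ is also at most linearly growing; i.e., if θ(t) ≤ a t + b and θ(t) ≥ c > 0 for t large, the inequality ∫₀^t θ(τ)²dτ ≤ C₁ + C₂ t^ε θ(t)^{1-ε} fails for sufficiently large t. -/

import Mathlib

/-- A function that stays positive cannot satisfy `G' ≥ k t^{-q} G^p` for all large times when
`p > 1` and `q < 1`: it would blow up in finite time. -/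
theorem not_forall_rpow_le_deriv {G g : ℝ → ℝ} {T k p q : ℝ} (hT : 0 < T) (hk : 0 < k)
    (hp : 1 < p) (hq : q < 1) (hG : ∀ t, T ≤ t → HasDerivAt G (g t) t)
    (hpos : ∀ t, T ≤ t → 0 < G t) :
    ¬ ∀ t, T ≤ t → k * t ^ (-q) * G t ^ p ≤ g t := by
  intro h
  set K := (p - 1) * k / (1 - q) with hK
  have hq' : 0 < 1 - q := by linarith
  have hKpos : 0 < K := div_pos (mul_pos (by linarith) hk) hq'
  set M : ℝ → ℝ := fun t => G t ^ (1 - p) + K * t ^ (1 - q) with hM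
  have hder : ∀ t, T ≤ t →
      HasDerivAt M (g t * (1 - p) * G t ^ (1 - p - 1) + K * ((1 - q) * t ^ (1 - q - 1))) t := by
    intro t ht
    exact ((hG t ht).rpow_const (Or.inl (hpos t ht).ne')).add
      ((Real.hasDerivAt_rpow_const (Or.inl (hT.trans_le ht).ne')).const_mul K)
  have hanti : AntitoneOn M (Set.Ici T) := by
    apply antitoneOn_of_deriv_nonpos (convex_Ici T)
    · exact fun t ht => (hder t ht).continuousAt.continuousWithinAt
    · intro t ht
      exact (hder t (interior_subset ht)).differentiableAt.differentiableWithinAt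
    · intro t ht
      have ht' : T ≤ t := interior_subset ht
      rw [(hder t ht').deriv]
      have hGp : 0 < G t ^ p := Real.rpow_pos_of_pos (hpos t ht') p
      have hle : k * t ^ (-q) ≤ g t * (G t ^ p)⁻¹ := by
        rw [← div_eq_mul_inv, le_div_iff₀ hGp]
        exact h t ht'
      rw [show 1 - p - 1 = -p by ring, show 1 - q - 1 = -q by ring,
        Real.rpow_neg (hpos t ht').le, ← mul_assoc K, hK, div_mul_cancel₀ _ hq'.ne']
      nlinarith [mul_le_mul_of_nonneg_left hle (sub_pos.2 hp).le]
  obtain ⟨t, hMt, ht⟩ := (((tendsto_rpow_atTop hq').const_mul_atTop hKpos).eventually_gt_atTop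
    (M T) |>.and (Filter.eventually_ge_atTop T)).exists
  have h1 : M t ≤ M T := hanti Set.self_mem_Ici ht ht
  have h2 : 0 < G t ^ (1 - p) := Real.rpow_pos_of_pos (hpos t ht) _
  simp only [hM] at h1 hMt
  linarith

/-- If a continuous `θ` is bounded below by `c > 0` and at most linearly growing for large
times, then the integral inequality `∫₀^t θ² ≤ C₁ + C₂ t^ε θ(t)^{1-ε}` cannot hold for all
large `t`. -/
theorem stmt16 (θ : ℝ → ℝ) (hc : Continuous θ) (a b c C₁ C₂ T₀ ε : ℝ)
    (hcpos : 0 < c) (hε0 : 0 < ε) (hε : ε < 1 / 3)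
    (hnn : ∀ t : ℝ, 0 ≤ t → 0 ≤ θ t) (hT₀ : 0 ≤ T₀)
    (hlow : ∀ t : ℝ, T₀ ≤ t → c ≤ θ t) (hup : ∀ t : ℝ, T₀ ≤ t → θ t ≤ a * t + b) :
    ¬ ∀ t : ℝ, T₀ ≤ t →
        ∫ τ in (0:ℝ)..t, (θ τ) ^ 2 ≤ C₁ + C₂ * t ^ ε * (θ t) ^ (1 - ε) := by
  intro h
  have hint : ∀ u v : ℝ, IntervalIntegrable (fun τ => θ τ ^ 2) MeasureTheory.volume u v :=
    fun u v => (hc.pow 2).intervalIntegrable u v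
  have hlin : ∀ t, T₀ ≤ t → c ^ 2 * (t - T₀) ≤ ∫ τ in (0:ℝ)..t, θ τ ^ 2 := by
    intro t ht
    rw [← intervalIntegral.integral_add_adjacent_intervals (hint 0 T₀) (hint T₀ t)]
    have h1 : 0 ≤ ∫ τ in (0:ℝ)..T₀, θ τ ^ 2 :=
      intervalIntegral.integral_nonneg hT₀ fun τ _ => sq_nonneg _
    have h2 : ∫ _ in T₀..t, c ^ 2 ≤ ∫ τ in T₀..t, θ τ ^ 2 :=
      intervalIntegral.integral_mono_on ht intervalIntegrable_const (hint T₀ t)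
        fun τ hτ => pow_le_pow_left₀ hcpos.le (hlow τ hτ.1) 2
    rw [intervalIntegral.integral_const, smul_eq_mul] at h2
    linarith
  set T := T₀ + (|C₁| + 1) / c ^ 2 with hTdef
  have hd : 0 < (|C₁| + 1) / c ^ 2 := by positivity
  have hTT : T₀ ≤ T := by linarith
  have hT : 0 < T := by linarith
  set G : ℝ → ℝ := fun t => (∫ τ in (0:ℝ)..t, θ τ ^ 2) - C₁ with hGdef
  have hGpos : ∀ t, T ≤ t → 0 < G t := by
    intro t ht
    have h1 := hlin t (hTT.trans ht)
    have h2 : |C₁| + 1 ≤ c ^ 2 * (t - T₀) := by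
      rw [← div_le_iff₀' (by positivity)]
      linarith
    have := le_abs_self C₁
    simp only [hGdef]
    linarith
  have hGle : ∀ t, T ≤ t → G t ≤ C₂ * t ^ ε * θ t ^ (1 - ε) := by
    intro t ht
    have := h t (hTT.trans ht)
    simp only [hGdef]
    linarith
  have hθ : 0 < θ T := hcpos.trans_le (hlow T hTT)
  have hC₂ : 0 < C₂ := by
    have h1 := (hGpos T le_rfl).trans_le (hGle T le_rfl)
    rw [mul_assoc] at h1
    exact pos_of_mul_pos_left h1 (by positivity)
  have hε1 : 0 < 1 - ε := by linarith
  refine not_forall_rpow_le_deriv (G := G) (g := fun t => θ t ^ 2) (k := (C₂ ^ (2 / (1 - ε)))⁻¹)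
    (p := 2 / (1 - ε)) (q := ε * (2 / (1 - ε))) hT (by positivity) ?_ ?_ ?_ hGpos ?_
  · rw [lt_div_iff₀ hε1]
    linarith
  · rw [← mul_div_assoc, div_lt_one hε1]
    linarith
  · intro t _
    exact (hc.pow 2).integral_hasStrictDerivAt 0 t |>.hasDerivAt.sub_const C₁
  · intro t ht
    have ht0 : 0 < t := hT.trans_le ht
    have hθt : 0 < θ t := hcpos.trans_le (hlow t (hTT.trans ht))
    have hpow := Real.rpow_le_rpow (hGpos t ht).le (hGle t ht)
      (show 0 ≤ 2 / (1 - ε) by positivity)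
    rw [Real.mul_rpow (by positivity) (by positivity), Real.mul_rpow hC₂.le (by positivity),
      ← Real.rpow_mul ht0.le, ← Real.rpow_mul hθt.le, mul_div_cancel₀ _ hε1.ne',
      Real.rpow_two] at hpow
    rw [Real.rpow_neg ht0.le, ← mul_inv, inv_mul_le_iff₀ (by positivity)]
    exact hpow
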